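/- Let ρ = (w, G) be a weighted permutation representation that is not supersingular. Let m be the number of classes of the level set partition, and suppose m divides g and g/m is an odd prime number. Then δ_ρ = m if and only if ρ is not geometrically simple. -/

import Mathlib

open scoped BigOperators

namespace PaperAux

/-- The symbol set `X_{2g}`, modeled as `Fin g ⊕ Fin g`. -/
abbrev X (g : ℕ) := Fin g ⊕ Fin g

/-- The complex conjugation involution `c`, swapping `i` and `ī`. -/
def conjPerm (g : ℕ) : Equiv.Perm (X g) := Equiv.sumComm (Fin g) (Fin g)

/-- The group `W_{2g}`: the centralizer of `c` in `Sym(X_{2g})`. -/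
def Wgrp (g : ℕ) : Subgroup (Equiv.Perm (X g)) := Subgroup.centralizer {conjPerm g}

/-- `w` is a weight function. -/
structure IsWeightFn (g : ℕ) (w : X g → ℚ) : Prop where
  nonneg : ∀ x, 0 ≤ w x
  add_one : ∀ i : Fin g, w (Sum.inl i) + w (Sum.inr i) = 1
  mono : ∀ i j : Fin g, i ≤ j → w (Sum.inl i) ≤ w (Sum.inl j)
  den_dvd : ∀ s : ℚ, s.den ∣ (Finset.univ.filter fun x => w x = s).card

/-- The map `Φ_ρ : X → MonoidAlgebra ℚ G`,
`Φ_ρ(x) = ∑_{σ ∈ G} w(σ⁻¹ x) • (σ : MonoidAlgebra ℚ G)`. -/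
noncomputable def Phi {g : ℕ} (w : X g → ℚ) (G : Subgroup (Equiv.Perm (X g))) (x : X g) :
    MonoidAlgebra ℚ G :=
  ∑ᶠ σ : G, w (((σ : Equiv.Perm (X g))⁻¹) x) • MonoidAlgebra.of ℚ G σ

/-- The sum `∑_{σ ∈ G} σ` in the group algebra. -/
noncomputable def allSum {g : ℕ} (G : Subgroup (Equiv.Perm (X g))) : MonoidAlgebra ℚ G :=
  ∑ᶠ σ : G, MonoidAlgebra.of ℚ G σ

/-- `ρ = (w, G)` is geometrically simple (with base point `x₀ = Sum.inl 0`):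
the stabilizer of `Φ_ρ(x₀)` under left multiplication equals the stabilizer of `x₀`. -/
def GeomSimple {g : ℕ} (w : X g → ℚ) (G : Subgroup (Equiv.Perm (X g))) (x₀ : X g) : Prop :=
  ∀ σ : G, MonoidAlgebra.of ℚ G σ * Phi w G x₀ = Phi w G x₀ ↔ (σ : Equiv.Perm (X g)) x₀ = x₀

/-- The exceptionality identity for a pair of disjoint subsets `T⁺, T⁻ ⊆ Fin g`. -/
def ExcId {g : ℕ} (w : X g → ℚ) (G : Subgroup (Equiv.Perm (X g)))
    (Tp Tm : Finset (Fin g)) : Prop :=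
  (∑ i ∈ Tp, Phi w G (Sum.inl i)) - (∑ j ∈ Tm, Phi w G (Sum.inl j))
    = (((Tp.card : ℚ) - (Tm.card : ℚ)) / 2) • allSum G

/-- `ρ = (w, G)` is exceptional. -/
def IsExceptional {g : ℕ} (w : X g → ℚ) (G : Subgroup (Equiv.Perm (X g))) : Prop :=
  ∃ Tp Tm : Finset (Fin g), Disjoint Tp Tm ∧ (Tp ∪ Tm).Nonempty ∧
    Even (Tp.card + Tm.card) ∧ ExcId w G Tp Tm

/-- The induced map `σ⁺ : Fin g → Fin g` of `σ ∈ W`. -/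
def plusFun {g : ℕ} (σ : Equiv.Perm (X g)) (i : Fin g) : Fin g :=
  Sum.elim id id (σ (Sum.inl i))

/-- The level set equivalence relation on `Fin g`. -/
def levelRel {g : ℕ} (G : Subgroup (Equiv.Perm (X g))) (i j : Fin g) : Prop :=
  ∀ γ ∈ G, (∀ k, plusFun γ k = k) →
    ((γ (Sum.inl i) = Sum.inr i) ↔ (γ (Sum.inl j) = Sum.inr j))

/-- The level set partition, as a setoid. -/
def levelSetoid {g : ℕ} (G : Subgroup (Equiv.Perm (X g))) : Setoid (Fin g) where
  r := levelRel G
  iseqv := ⟨fun _ _ _ _ => Iff.rfl,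
            fun h γ hγ h2 => (h γ hγ h2).symm,
            fun h1 h2 γ hγ h3 => (h1 γ hγ h3).trans (h2 γ hγ h3)⟩

/-- `m`: the number of classes of the level set partition. -/
noncomputable def numLevels {g : ℕ} (G : Subgroup (Equiv.Perm (X g))) : ℕ :=
  Nat.card (Quotient (levelSetoid G))

/-- The angle rank `δ_ρ` of a weighted permutation representation. -/
noncomputable def angleRank {g : ℕ} (w : X g → ℚ) (G : Subgroup (Equiv.Perm (X g))) : ℕ :=
  Module.finrank ℚ (Submodule.span ℚ (Set.range (Phi w G))) - 1

end PaperAux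

open PaperAux

namespace PaperAux

variable {g : ℕ} {w : X g → ℚ} {G : Subgroup (Equiv.Perm (X g))}

/-- The index in `Fin g` underlying a symbol. -/
def index (x : X g) : Fin g := Sum.elim id id x

@[simp] lemma index_inl (i : Fin g) : index (Sum.inl i : X g) = i := rfl

@[simp] lemma index_inr (i : Fin g) : index (Sum.inr i : X g) = i := rfl

@[simp] lemma conjPerm_inl (i : Fin g) : conjPerm g (Sum.inl i) = Sum.inr i := rfl

@[simp] lemma conjPerm_inr (i : Fin g) : conjPerm g (Sum.inr i) = Sum.inl i := rfl

@[simp] lemma conjPerm_conjPerm (x : X g) : conjPerm g (conjPerm g x) = x := by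
  cases x <;> rfl

@[simp] lemma index_conjPerm (x : X g) : index (conjPerm g x) = index x := by
  cases x <;> rfl

lemma index_eq_iff {x y : X g} : index x = index y ↔ x = y ∨ x = conjPerm g y := by
  cases x <;> cases y <;> simp

lemma apply_conjPerm (hGW : G ≤ Wgrp g) {σ : Equiv.Perm (X g)} (hσ : σ ∈ G) (x : X g) :
    σ (conjPerm g x) = conjPerm g (σ x) := by
  have h := Subgroup.mem_centralizer_iff.1 (hGW hσ) _ rfl
  exact (Equiv.Perm.congr_fun h x).symm

lemma plusFun_fixed_iff (hGW : G ≤ Wgrp g) {γ : Equiv.Perm (X g)} (hγ : γ ∈ G) :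
    (∀ k, plusFun γ k = k) ↔ ∀ x, index (γ x) = index x := by
  refine ⟨fun h x => ?_, fun h k => h (Sum.inl k)⟩
  rcases x with k | k
  · exact h k
  · rw [← conjPerm_inl, apply_conjPerm hGW hγ, index_conjPerm]
    exact h k

lemma apply_eq_conjPerm_congr (hGW : G ≤ Wgrp g) {γ : Equiv.Perm (X g)} (hγ : γ ∈ G)
    {x y : X g} (hxy : index x = index y) : γ x = conjPerm g x ↔ γ y = conjPerm g y := by
  rcases index_eq_iff.1 hxy with rfl | rfl
  · rfl
  · rw [apply_conjPerm hGW hγ, (conjPerm g).injective.eq_iff]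

lemma levelRel_index_iff (hGW : G ≤ Wgrp g) (x y : X g) :
    levelRel G (index x) (index y) ↔ ∀ γ ∈ G, (∀ z, index (γ z) = index z) →
      (γ x = conjPerm g x ↔ γ y = conjPerm g y) := by
  refine forall₂_congr fun γ hγ => ?_
  rw [plusFun_fixed_iff hGW hγ, ← conjPerm_inl, ← conjPerm_inl,
    apply_eq_conjPerm_congr hGW hγ (index_inl (index x)),
    apply_eq_conjPerm_congr hGW hγ (index_inl (index y))]

/-- A relation on `Fin g` is invariant under the action of `G` on indices. -/
def IndexInvariant (G : Subgroup (Equiv.Perm (X g))) (R : Fin g → Fin g → Prop) : Prop :=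
  ∀ σ ∈ G, ∀ x y : X g, R (index x) (index y) → R (index (σ x)) (index (σ y))

lemma index_apply_eq_iff (hGW : G ≤ Wgrp g) {σ : Equiv.Perm (X g)} (hσ : σ ∈ G) (x y : X g) :
    index (σ x) = index (σ y) ↔ index x = index y := by
  rw [index_eq_iff, index_eq_iff, ← apply_conjPerm hGW hσ, σ.injective.eq_iff,
    σ.injective.eq_iff]

lemma levelRel_indexInvariant (hGW : G ≤ Wgrp g) : IndexInvariant G (levelRel G) := by
  intro σ hσ x y h
  rw [levelRel_index_iff hGW] at h ⊢
  intro γ hγ hfix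
  have hconj := h (σ⁻¹ * γ * σ) (mul_mem (mul_mem (inv_mem hσ) hγ) hσ) fun z => by
    rw [← index_apply_eq_iff hGW hσ]
    simpa using hfix (σ z)
  simpa only [Equiv.Perm.mul_apply, Equiv.Perm.inv_eq_iff_eq, apply_conjPerm hGW hσ] using hconj

open Classical in
lemma card_class_eq (hGW : G ≤ Wgrp g) (htrans : ∀ x y : X g, ∃ σ ∈ G, σ x = y)
    {R : Fin g → Fin g → Prop} (hR : IndexInvariant G R) (i j : Fin g) :
    (Finset.univ.filter (R i)).card = (Finset.univ.filter (R j)).card := by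
  suffices h : ∀ i j, (Finset.univ.filter (R i)).card ≤ (Finset.univ.filter (R j)).card from
    le_antisymm (h i j) (h j i)
  intro i j
  obtain ⟨σ, hσ, hij⟩ := htrans (Sum.inl i) (Sum.inl j)
  refine Finset.card_le_card_of_injOn (fun k => index (σ (Sum.inl k))) ?_ ?_
  · intro k hk
    have := hR σ hσ (Sum.inl i) (Sum.inl k) (by simpa using hk)
    simpa [hij] using this
  · intro k _ l _ hkl
    simpa using (index_apply_eq_iff hGW hσ _ _).1 hkl

open Classical in
lemma card_eq_mul_of_saturated {α : Type*} [Fintype α] (T : Setoid α) {t : ℕ}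
    (ht : ∀ i, (Finset.univ.filter (T i)).card = t) (s : Finset α)
    (hs : ∀ i ∈ s, ∀ j, T i j → j ∈ s) :
    s.card = (s.image (Quotient.mk T)).card * t := by
  rw [Finset.card_eq_sum_card_image (Quotient.mk T) s, Finset.sum_const_nat]
  intro q hq
  obtain ⟨i, hi, rfl⟩ := Finset.mem_image.1 hq
  rw [← ht i]
  congr 1
  ext j
  simp only [Finset.mem_filter, Finset.mem_univ, true_and, Quotient.eq]
  exact ⟨fun h => T.symm h.2, fun h => ⟨hs i hi j h, T.symm h⟩⟩

open Classical in
lemma card_level_class (hg : 0 < g) (hGW : G ≤ Wgrp g)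
    (htrans : ∀ x y : X g, ∃ σ ∈ G, σ x = y) (i : Fin g) :
    (Finset.univ.filter (levelSetoid G i)).card = g / numLevels G := by
  have h := card_eq_mul_of_saturated (levelSetoid G)
    (fun j => card_class_eq hGW htrans (levelRel_indexInvariant hGW) j i) Finset.univ (by simp)
  rw [Finset.image_univ_of_surjective Quotient.mk_surjective, Finset.card_univ,
    Finset.card_univ, Fintype.card_fin, ← Nat.card_eq_fintype_card] at h
  change g = numLevels G * _ at h
  exact (Nat.div_eq_of_eq_mul_right (Nat.pos_of_ne_zero fun h0 => by simp_all) h).symm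

/-- The coefficients `2 w(σ⁻¹ x) - 1` of `Φ(x) - Φ(c x)`. -/
def oddCoeff (w : X g → ℚ) (G : Subgroup (Equiv.Perm (X g))) (x : X g) (σ : G) : ℚ :=
  2 * w ((σ : Equiv.Perm (X g))⁻¹ x) - 1

lemma coeff_Phi (x : X g) (σ : G) :
    (Phi w G x).coeff σ = w ((σ : Equiv.Perm (X g))⁻¹ x) := by
  classical
  have : Fintype G := Fintype.ofFinite G
  rw [Phi, finsum_eq_sum_of_fintype, MonoidAlgebra.coeff_sum, Finsupp.finsetSum_apply]
  simp [MonoidAlgebra.of_apply, MonoidAlgebra.coeff_single, Finsupp.single_apply]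

lemma of_mul_Phi (σ : G) (x : X g) :
    MonoidAlgebra.of ℚ G σ * Phi w G x = Phi w G ((σ : Equiv.Perm (X g)) x) := by
  apply MonoidAlgebra.coeff_injective
  ext τ
  rw [coeff_Phi, MonoidAlgebra.of_apply,
    MonoidAlgebra.coeff_single_mul_eq_mul_coeff (σ⁻¹ * τ) (by simp [eq_inv_mul_iff_mul_eq]),
    coeff_Phi]
  simp

lemma Phi_eq_iff (x y : X g) : Phi w G x = Phi w G y ↔ oddCoeff w G x = oddCoeff w G y := by
  rw [← MonoidAlgebra.coeff_inj, Finsupp.ext_iff, funext_iff]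
  simp [coeff_Phi, oddCoeff]

lemma geomSimple_iff (htrans : ∀ x y : X g, ∃ σ ∈ G, σ x = y) (x₀ : X g) :
    GeomSimple w G x₀ ↔ ∀ x, oddCoeff w G x = oddCoeff w G x₀ → x = x₀ := by
  simp only [GeomSimple, of_mul_Phi, Phi_eq_iff]
  refine ⟨fun h x hx => ?_, fun h σ => ⟨h _, fun hσ => by rw [hσ]⟩⟩
  obtain ⟨σ, hσ, rfl⟩ := htrans x₀ x
  exact (h ⟨σ, hσ⟩).1 hx

lemma IsWeightFn.conjPerm_apply (hw : IsWeightFn g w) (x : X g) :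
    w (conjPerm g x) = 1 - w x := by
  rcases x with i | i <;> have := hw.add_one i <;> simp <;> linarith

lemma oddCoeff_conjPerm (hw : IsWeightFn g w) (hGW : G ≤ Wgrp g) (x : X g) :
    oddCoeff w G (conjPerm g x) = -oddCoeff w G x := by
  ext σ
  simp only [oddCoeff, Pi.neg_apply]
  rw [apply_conjPerm hGW (inv_mem σ.2), hw.conjPerm_apply]
  ring

lemma oddCoeff_eq_or_neg_of_index_eq (hw : IsWeightFn g w) (hGW : G ≤ Wgrp g) {x y : X g}
    (h : index x = index y) :
    oddCoeff w G x = oddCoeff w G y ∨ oddCoeff w G x = -oddCoeff w G y := by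
  rcases index_eq_iff.1 h with rfl | rfl
  · exact Or.inl rfl
  · exact Or.inr (oddCoeff_conjPerm hw hGW y)

lemma oddCoeff_apply (γ : G) (x : X g) (σ : G) :
    oddCoeff w G ((γ : Equiv.Perm (X g)) x) σ = oddCoeff w G x (γ⁻¹ * σ) := by
  simp [oddCoeff]

lemma dotProduct_oddCoeff_apply [Fintype G] (γ : G) (x y : X g) :
    oddCoeff w G ((γ : Equiv.Perm (X g)) x) ⬝ᵥ oddCoeff w G ((γ : Equiv.Perm (X g)) y) =
      oddCoeff w G x ⬝ᵥ oddCoeff w G y := by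
  simp only [dotProduct, oddCoeff_apply]
  exact Equiv.sum_comp (Equiv.mulLeft γ⁻¹) fun σ => oddCoeff w G x σ * oddCoeff w G y σ

lemma one_dotProduct_oddCoeff [Fintype G] (hw : IsWeightFn g w) (hGW : G ≤ Wgrp g)
    (hc : conjPerm g ∈ G) (x : X g) : (1 : G → ℚ) ⬝ᵥ oddCoeff w G x = 0 := by
  have h : (1 : G → ℚ) ⬝ᵥ oddCoeff w G (conjPerm g x) = 1 ⬝ᵥ oddCoeff w G x := by
    simp only [one_dotProduct]
    have := oddCoeff_apply (w := w) (⟨_, hc⟩ : G) x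
    simp only [this]
    exact Equiv.sum_comp (Equiv.mulLeft (⟨_, hc⟩ : G)⁻¹) fun σ => oddCoeff w G x σ
  rw [oddCoeff_conjPerm hw hGW, dotProduct_neg] at h
  linarith

lemma dotProduct_oddCoeff_self (htrans : ∀ x y : X g, ∃ σ ∈ G, σ x = y) [Fintype G]
    (x y : X g) :
    oddCoeff w G x ⬝ᵥ oddCoeff w G x = oddCoeff w G y ⬝ᵥ oddCoeff w G y := by
  obtain ⟨σ, hσ, rfl⟩ := htrans x y
  exact (dotProduct_oddCoeff_apply ⟨σ, hσ⟩ x x).symm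

lemma dotProduct_oddCoeff_self_ne_zero (htrans : ∀ x y : X g, ∃ σ ∈ G, σ x = y)
    (hss : ¬ ∀ x : X g, w x = 1 / 2) [Fintype G] (x : X g) :
    oddCoeff w G x ⬝ᵥ oddCoeff w G x ≠ 0 := by
  obtain ⟨y, hy⟩ := not_forall.1 hss
  rw [dotProduct_oddCoeff_self htrans x y]
  intro h
  have h1 := congrFun (dotProduct_self_eq_zero.1 h) 1
  simp only [oddCoeff, OneMemClass.coe_one, inv_one, Equiv.Perm.coe_one, id_eq,
    Pi.zero_apply] at h1
  exact hy (by linarith)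

lemma dotProduct_oddCoeff_eq_zero (hw : IsWeightFn g w) (hGW : G ≤ Wgrp g) [Fintype G]
    {x y : X g} (h : ¬ levelRel G (index x) (index y)) :
    oddCoeff w G x ⬝ᵥ oddCoeff w G y = 0 := by
  rw [levelRel_index_iff hGW] at h
  push Not at h
  obtain ⟨γ, hγ, hfix, h⟩ := h
  have hdot := dotProduct_oddCoeff_apply (w := w) ⟨γ, hγ⟩ x y
  simp only at hdot
  rcases h with ⟨hx, hy⟩ | ⟨hx, hy⟩
  · have hy' := (index_eq_iff.1 (hfix y)).resolve_right hy
    rw [hx, hy', oddCoeff_conjPerm hw hGW, neg_dotProduct] at hdot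
    linarith
  · have hx' := (index_eq_iff.1 (hfix x)).resolve_right hx
    rw [hx', hy, oddCoeff_conjPerm hw hGW, dotProduct_neg] at hdot
    linarith

lemma angleRank_eq_finrank_oddCoeff (hg : 0 < g) (hw : IsWeightFn g w) (hGW : G ≤ Wgrp g)
    (hc : conjPerm g ∈ G) :
    angleRank w G = Module.finrank ℚ (Submodule.span ℚ (Set.range (oddCoeff w G))) := by
  have : Fintype G := Fintype.ofFinite G
  let e : MonoidAlgebra ℚ G ≃ₗ[ℚ] (G → ℚ) :=
    (MonoidAlgebra.coeffLinearEquiv ℚ).trans (Finsupp.linearEquivFunOnFinite ℚ ℚ G)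
  have he : ∀ x, e (Phi w G x) = (2⁻¹ : ℚ) • (oddCoeff w G x + 1) := by
    intro x
    ext σ
    change (Phi w G x).coeff σ = _
    simp [coeff_Phi, oddCoeff]
  have hmap : (Submodule.span ℚ (Set.range (Phi w G))).map (e : MonoidAlgebra ℚ G →ₗ[ℚ] G → ℚ) =
      Submodule.span ℚ {1} ⊔ Submodule.span ℚ (Set.range (oddCoeff w G)) := by
    rw [Submodule.map_span, ← Set.range_comp]
    apply le_antisymm
    · rw [Submodule.span_le]
      rintro _ ⟨x, rfl⟩
      simp only [Function.comp_apply, LinearEquiv.coe_coe, he]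
      exact Submodule.smul_mem _ _ (add_mem
        (Submodule.mem_sup_right (Submodule.subset_span ⟨x, rfl⟩))
        (Submodule.mem_sup_left (Submodule.mem_span_singleton_self _)))
    · have hmem : ∀ x, (2⁻¹ : ℚ) • (oddCoeff w G x + 1) ∈ Submodule.span ℚ
          (Set.range ((e : MonoidAlgebra ℚ G →ₗ[ℚ] G → ℚ) ∘ Phi w G)) := fun x =>
        he x ▸ Submodule.subset_span ⟨x, rfl⟩
      have hone : (1 : G → ℚ) ∈ Submodule.span ℚ
          (Set.range ((e : MonoidAlgebra ℚ G →ₗ[ℚ] G → ℚ) ∘ Phi w G)) := by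
        have := add_mem (hmem (Sum.inl ⟨0, hg⟩)) (hmem (conjPerm g (Sum.inl ⟨0, hg⟩)))
        rw [oddCoeff_conjPerm hw hGW] at this
        convert this using 1
        module
      refine sup_le ?_ ?_
      · rwa [Submodule.span_singleton_le_iff_mem]
      · rw [Submodule.span_le]
        rintro _ ⟨x, rfl⟩
        have := sub_mem (Submodule.smul_mem _ (2 : ℚ) (hmem x)) hone
        rwa [smul_smul, mul_inv_cancel₀ two_ne_zero, one_smul, add_sub_cancel_right] at this
  have hdisj : Submodule.span ℚ {(1 : G → ℚ)} ⊓
      Submodule.span ℚ (Set.range (oddCoeff w G)) = ⊥ := by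
    rw [eq_bot_iff]
    rintro v ⟨hv1, hv2⟩
    obtain ⟨a, rfl⟩ := Submodule.mem_span_singleton.1 hv1
    have horth : ∀ v ∈ Submodule.span ℚ (Set.range (oddCoeff w G)), (1 : G → ℚ) ⬝ᵥ v = 0 := by
      intro v hv
      induction hv using Submodule.span_induction with
      | mem v hv =>
        obtain ⟨x, rfl⟩ := hv
        exact one_dotProduct_oddCoeff hw hGW hc x
      | zero => exact dotProduct_zero _
      | add u v _ _ hu hv => rw [dotProduct_add, hu, hv, add_zero]
      | smul b v _ hv => rw [dotProduct_smul, hv, smul_zero]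
    have h := horth _ hv2
    rw [Submodule.mem_bot, ← dotProduct_self_eq_zero, smul_dotProduct, h, smul_zero]
  have hdim := Submodule.finrank_sup_add_finrank_inf_eq (Submodule.span ℚ {(1 : G → ℚ)})
    (Submodule.span ℚ (Set.range (oddCoeff w G)))
  rw [hdisj, finrank_bot, finrank_span_singleton one_ne_zero, ← hmap,
    LinearEquiv.finrank_map_eq] at hdim
  rw [angleRank]
  omega

/-- The vector of odd coefficients at a representative of a level class. -/
noncomputable def levelVec (w : X g → ℚ) (G : Subgroup (Equiv.Perm (X g)))
    (q : Quotient (levelSetoid G)) : G → ℚ :=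
  oddCoeff w G (Sum.inl q.out)

lemma levelRel_of_dotProduct_levelVec_ne_zero (hw : IsWeightFn g w) (hGW : G ≤ Wgrp g)
    [Fintype G] {q : Quotient (levelSetoid G)} {x : X g}
    (h : oddCoeff w G x ⬝ᵥ levelVec w G q ≠ 0) : Quotient.mk _ (index x) = q := by
  rw [← q.out_eq]
  refine Quotient.sound ?_
  by_contra hne
  exact h (dotProduct_oddCoeff_eq_zero hw hGW (y := Sum.inl q.out) hne)

open Classical in
lemma sum_smul_levelVec_dotProduct (hw : IsWeightFn g w) (hGW : G ≤ Wgrp g) [Fintype G]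
    (a : Quotient (levelSetoid G) → ℚ) (q : Quotient (levelSetoid G)) :
    (∑ p, a p • levelVec w G p) ⬝ᵥ levelVec w G q =
      a q * (levelVec w G q ⬝ᵥ levelVec w G q) := by
  rw [sum_dotProduct, Finset.sum_eq_single q]
  · rw [smul_dotProduct, smul_eq_mul]
  · intro p _ hpq
    rw [smul_dotProduct, smul_eq_mul, mul_eq_zero]
    refine Or.inr (by_contra fun h => hpq ?_)
    rw [← levelRel_of_dotProduct_levelVec_ne_zero hw hGW h, index_inl, Quotient.out_eq]
  · simp

lemma linearIndependent_levelVec (hw : IsWeightFn g w) (hGW : G ≤ Wgrp g)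
    (htrans : ∀ x y : X g, ∃ σ ∈ G, σ x = y) (hss : ¬ ∀ x : X g, w x = 1 / 2) :
    LinearIndependent ℚ (levelVec w G) := by
  classical
  have : Fintype G := Fintype.ofFinite G
  rw [Fintype.linearIndependent_iff]
  intro a ha q
  have h := sum_smul_levelVec_dotProduct hw hGW a q
  rw [ha, zero_dotProduct] at h
  exact (mul_eq_zero.1 h.symm).resolve_right (dotProduct_oddCoeff_self_ne_zero htrans hss _)

lemma angleRank_eq_numLevels_iff_span (hg : 0 < g) (hw : IsWeightFn g w) (hGW : G ≤ Wgrp g)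
    (hc : conjPerm g ∈ G) (htrans : ∀ x y : X g, ∃ σ ∈ G, σ x = y)
    (hss : ¬ ∀ x : X g, w x = 1 / 2) :
    angleRank w G = numLevels G ↔
      ∀ x, oddCoeff w G x ∈ Submodule.span ℚ (Set.range (levelVec w G)) := by
  classical
  have : Fintype G := Fintype.ofFinite G
  have hcard : Module.finrank ℚ (Submodule.span ℚ (Set.range (levelVec w G))) = numLevels G := by
    rw [finrank_span_eq_card (linearIndependent_levelVec hw hGW htrans hss), numLevels,
      Nat.card_eq_fintype_card]
  have hle : Submodule.span ℚ (Set.range (levelVec w G)) ≤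
      Submodule.span ℚ (Set.range (oddCoeff w G)) :=
    Submodule.span_mono (by rintro _ ⟨q, rfl⟩; exact ⟨_, rfl⟩)
  rw [angleRank_eq_finrank_oddCoeff hg hw hGW hc, ← hcard]
  constructor
  · intro h x
    rw [Submodule.eq_of_le_of_finrank_le hle h.le]
    exact Submodule.subset_span ⟨x, rfl⟩
  · intro h
    rw [le_antisymm hle (Submodule.span_le.2 (by rintro _ ⟨x, rfl⟩; exact h x))]

/-- Symbols with equal or opposite odd coefficients, as an equivalence relation on indices. -/
def signSetoid (w : X g → ℚ) (G : Subgroup (Equiv.Perm (X g))) : Setoid (Fin g) where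
  r i j := oddCoeff w G (Sum.inl i) = oddCoeff w G (Sum.inl j) ∨
    oddCoeff w G (Sum.inl i) = -oddCoeff w G (Sum.inl j)
  iseqv := ⟨fun _ => Or.inl rfl, by grind, by grind⟩

lemma signSetoid_index_iff (hw : IsWeightFn g w) (hGW : G ≤ Wgrp g) (x y : X g) :
    signSetoid w G (index x) (index y) ↔
      oddCoeff w G x = oddCoeff w G y ∨ oddCoeff w G x = -oddCoeff w G y := by
  change (_ ∨ _) ↔ _
  have hx := oddCoeff_eq_or_neg_of_index_eq hw hGW (index_inl (index x))
  have hy := oddCoeff_eq_or_neg_of_index_eq hw hGW (index_inl (index y))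
  grind

lemma signSetoid_indexInvariant (hw : IsWeightFn g w) (hGW : G ≤ Wgrp g) :
    IndexInvariant G (signSetoid w G) := by
  intro σ hσ x y h
  rw [signSetoid_index_iff hw hGW] at h ⊢
  have hσ' := fun z => funext (oddCoeff_apply (w := w) (⟨σ, hσ⟩ : G) z)
  simp only at hσ'
  rw [hσ', hσ']
  rcases h with h | h
  · exact Or.inl (by rw [h])
  · exact Or.inr (by rw [h]; rfl)

lemma signSetoid_le_levelSetoid (hw : IsWeightFn g w) (hGW : G ≤ Wgrp g)
    (htrans : ∀ x y : X g, ∃ σ ∈ G, σ x = y) (hss : ¬ ∀ x : X g, w x = 1 / 2) :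
    signSetoid w G ≤ levelSetoid G := by
  have : Fintype G := Fintype.ofFinite G
  intro i j h
  by_contra hne
  have hdot := dotProduct_oddCoeff_eq_zero hw hGW (x := Sum.inl i) (y := Sum.inl j) hne
  have hj := dotProduct_oddCoeff_self_ne_zero htrans hss (Sum.inl j)
  rcases h with h | h <;> rw [h] at hdot
  · exact hj hdot
  · rw [neg_dotProduct, neg_eq_zero] at hdot
    exact hj hdot

lemma not_geomSimple_iff_signSetoid (hw : IsWeightFn g w) (hGW : G ≤ Wgrp g)
    (htrans : ∀ x y : X g, ∃ σ ∈ G, σ x = y) (hss : ¬ ∀ x : X g, w x = 1 / 2) (i : Fin g) :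
    ¬ GeomSimple w G (Sum.inl i) ↔ ∃ j ≠ i, signSetoid w G i j := by
  have : Fintype G := Fintype.ofFinite G
  rw [geomSimple_iff htrans]
  push Not
  constructor
  · rintro ⟨x, hx, hne⟩
    refine ⟨index x, fun h => ?_, ?_⟩
    · rw [(index_eq_iff.1 (h.trans (index_inl i).symm)).resolve_left hne,
        oddCoeff_conjPerm hw hGW, neg_eq_self] at hx
      exact dotProduct_oddCoeff_self_ne_zero htrans hss (Sum.inl i) (by rw [hx, dotProduct_zero])
    · exact (signSetoid_index_iff hw hGW (Sum.inl i) x).2 (Or.inl hx.symm)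
  · rintro ⟨j, hji, h | h⟩
    · exact ⟨Sum.inl j, h.symm, by simpa using hji⟩
    · exact ⟨Sum.inr j, by rw [← conjPerm_inl, oddCoeff_conjPerm hw hGW, h], by simp⟩

lemma angleRank_eq_numLevels_iff_levelSetoid_le (hg : 0 < g) (hw : IsWeightFn g w)
    (hGW : G ≤ Wgrp g) (hc : conjPerm g ∈ G) (htrans : ∀ x y : X g, ∃ σ ∈ G, σ x = y)
    (hss : ¬ ∀ x : X g, w x = 1 / 2) :
    angleRank w G = numLevels G ↔ levelSetoid G ≤ signSetoid w G := by
  classical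
  have : Fintype G := Fintype.ofFinite G
  rw [angleRank_eq_numLevels_iff_span hg hw hGW hc htrans hss]
  constructor
  · intro h
    suffices key : ∀ i, signSetoid w G i (Quotient.mk (levelSetoid G) i).out by
      intro i j hij
      have hj := key j
      rw [← Quotient.sound (s := levelSetoid G) hij] at hj
      exact (signSetoid w G).trans (key i) ((signSetoid w G).symm hj)
    intro i
    obtain ⟨a, ha⟩ := (Submodule.mem_span_range_iff_exists_fun ℚ).1 (h (Sum.inl i))
    have hzero : ∀ q, q ≠ Quotient.mk (levelSetoid G) i → a q = 0 := by
      intro q hq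
      have hdot := sum_smul_levelVec_dotProduct hw hGW a q
      by_contra haq
      refine hq (levelRel_of_dotProduct_levelVec_ne_zero hw hGW (x := Sum.inl i) ?_).symm
      rw [← ha, hdot]
      exact mul_ne_zero haq (dotProduct_oddCoeff_self_ne_zero htrans hss _)
    rw [Finset.sum_eq_single (Quotient.mk (levelSetoid G) i)
      (fun q _ hq => by rw [hzero q hq, zero_smul]) (by simp)] at ha
    set q := Quotient.mk (levelSetoid G) i
    have hnorm := dotProduct_oddCoeff_self (w := w) htrans (Sum.inl i) (Sum.inl q.out)
    have hne := dotProduct_oddCoeff_self_ne_zero htrans hss (Sum.inl q.out)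
    rw [← ha, smul_dotProduct, dotProduct_smul, levelVec, smul_smul, smul_eq_mul,
      mul_eq_right₀ hne, mul_self_eq_one_iff] at hnorm
    rcases hnorm with h1 | h1 <;> rw [h1] at ha
    · exact Or.inl (by rw [← ha, one_smul]; rfl)
    · exact Or.inr (by rw [← ha, neg_one_smul]; rfl)
  · intro h x
    have hrel : levelSetoid G (index x) (Quotient.mk (levelSetoid G) (index x)).out :=
      (levelSetoid G).symm (Quotient.mk_out _)
    have hmem : levelVec w G (Quotient.mk (levelSetoid G) (index x)) ∈
        Submodule.span ℚ (Set.range (levelVec w G)) := Submodule.subset_span ⟨_, rfl⟩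
    rcases (signSetoid_index_iff hw hGW x (Sum.inl _)).1 (h hrel) with h | h
    · exact h ▸ hmem
    · exact h ▸ neg_mem hmem

end PaperAux

/-- if `ρ` is not supersingular, `m ∣ g` and `g/m` is an odd prime, then
`δ_ρ = m` iff `ρ` is not geometrically simple. -/
theorem angleRank_eq_numLevels_iff {g : ℕ} (hg : 0 < g) (w : X g → ℚ) (hw : IsWeightFn g w)
    (G : Subgroup (Equiv.Perm (X g))) (hGW : G ≤ Wgrp g) (hc : conjPerm g ∈ G)
    (htrans : ∀ x y : X g, ∃ σ ∈ G, σ x = y)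
    (hss : ¬ (∀ x : X g, w x = 1/2))
    (hdvd : numLevels G ∣ g) (hprime : Nat.Prime (g / numLevels G))
    (hodd : Odd (g / numLevels G)) :
    angleRank w G = numLevels G ↔ ¬ GeomSimple w G (Sum.inl ⟨0, hg⟩) := by
  classical
  rw [angleRank_eq_numLevels_iff_levelSetoid_le hg hw hGW hc htrans hss,
    not_geomSimple_iff_signSetoid hw hGW htrans hss]
  have hle := signSetoid_le_levelSetoid hw hGW htrans hss
  constructor
  · intro h
    have hcard := card_level_class hg hGW htrans ⟨0, hg⟩
    obtain ⟨j, hj, hne⟩ := Finset.exists_mem_ne (hcard ▸ hprime.one_lt) ⟨0, hg⟩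
    exact ⟨j, hne, h (Finset.mem_filter.1 hj).2⟩
  · rintro ⟨j, hne, hj⟩ i k hik
    have hsign := fun l =>
      card_class_eq hGW htrans (signSetoid_indexInvariant hw hGW) l ⟨0, hg⟩
    have hmul := card_eq_mul_of_saturated (signSetoid w G) hsign
      (Finset.univ.filter (levelSetoid G i)) (by
        simp only [Finset.mem_filter, Finset.mem_univ, true_and]
        exact fun l hl l' hll' => (levelSetoid G).trans hl (hle hll'))
    have hone : 1 < (Finset.univ.filter (signSetoid w G ⟨0, hg⟩)).card :=
      Finset.one_lt_card.2 ⟨⟨0, hg⟩, by simp, j, by simpa using hj,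
        hne.symm⟩
    rw [card_level_class hg hGW htrans] at hmul
    have heq := (hprime.eq_one_or_self_of_dvd _ (Dvd.intro_left _ hmul.symm)).resolve_left hone.ne'
    have hfilter : Finset.univ.filter (signSetoid w G i) = Finset.univ.filter (levelSetoid G i) :=
      Finset.eq_of_subset_of_card_le (Finset.monotone_filter_right _ fun _ _ h => hle h)
        (by rw [card_level_class hg hGW htrans, hsign, heq])
    have hmem : k ∈ Finset.univ.filter (levelSetoid G i) := by simpa using hik
    rw [← hfilter] at hmem
    exact (Finset.mem_filter.1 hmem).2
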